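/- arXiv:2510.18924 — 11 statements merged into one kernel-verified Lean document; each statement's English description precedes it below -/
import Mathlib

section
/- Let Q be a finite nonempty type of queries with a probability mass function ρ : Q → ℝ (ρ(q) ≥ 0, ∑_q ρ(q) = 1), O a finite nonempty type of outputs, and r : Q → O → ℝ a reward taking values in {0,1}. Let π and π_k assign to each q ∈ Q a probability mass function on O, and set p_π(q) = ∑_o π(q)(o)·r(q)(o) and p_{π_k}(q) = ∑_o π_k(q)(o)·r(q)(o). Assume 0 < p_{π_k}(q) < 1 for every q, and set σ_k(q) = √(p_{π_k}(q)(1 − p_{π_k}(q))), L(q) = (p_π(q) − p_{π_k}(q))/σ_k(q), and TV(q) = (1/2)·∑_o |π(q)(o) − π_k(q)(o)|. Then ∑_q ρ(q)(p_π(q) − p_{π_k}(q)) ≥ ∑_q ρ(q)·L(q) − 2·√(∑_q ρ(q)·((1 − σ_k(q))/σ_k(q))²)·√(∑_q ρ(q)·TV(q)²). -/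
open Finset

/-- Cauchy-Schwarz inequality for finite sums with nonnegative weights. -/
theorem sum_weight_mul_le_sqrt_mul_sqrt {ι : Type*} (s : Finset ι) (w f g : ι → ℝ)
    (hw : ∀ i, 0 ≤ w i) :
    ∑ i ∈ s, w i * (f i * g i) ≤
      Real.sqrt (∑ i ∈ s, w i * f i ^ 2) * Real.sqrt (∑ i ∈ s, w i * g i ^ 2) := by
  have h := Real.sum_mul_le_sqrt_mul_sqrt s (fun i => Real.sqrt (w i) * f i)
    (fun i => Real.sqrt (w i) * g i)
  simp only [mul_pow, Real.sq_sqrt (hw _)] at h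
  convert h using 2 with i
  rw [mul_mul_mul_comm, Real.mul_self_sqrt (hw i)]

/-- Expectations of a function bounded by one differ by at most the `ℓ¹` distance. -/
theorem sum_mul_sub_sum_mul_le_sum_abs_sub {ι : Type*} (s : Finset ι) (u v f : ι → ℝ)
    (hf : ∀ i, |f i| ≤ 1) :
    ∑ i ∈ s, u i * f i - ∑ i ∈ s, v i * f i ≤ ∑ i ∈ s, |u i - v i| := by
  rw [← sum_sub_distrib]
  refine sum_le_sum fun i _ => ?_
  rw [← sub_mul]
  refine (le_abs_self _).trans ?_
  rw [abs_mul]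
  exact mul_le_of_le_one_right (abs_nonneg _) (hf i)

theorem grpo_policy_improvement
    (Q O : Type*) [Fintype Q] [Nonempty Q] [Fintype O] [Nonempty O]
    (ρ : Q → ℝ) (hρ0 : ∀ q, 0 ≤ ρ q) (hρ1 : ∑ q, ρ q = 1)
    (r : Q → O → ℝ) (hr : ∀ q o, r q o = 0 ∨ r q o = 1)
    (π πk : Q → O → ℝ)
    (hπ0 : ∀ q o, 0 ≤ π q o) (hπ1 : ∀ q, ∑ o, π q o = 1)
    (hπk0 : ∀ q o, 0 ≤ πk q o) (hπk1 : ∀ q, ∑ o, πk q o = 1)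
    (pπ pk : Q → ℝ)
    (hpπ : ∀ q, pπ q = ∑ o, π q o * r q o)
    (hpk : ∀ q, pk q = ∑ o, πk q o * r q o)
    (hpk0 : ∀ q, 0 < pk q) (hpk1 : ∀ q, pk q < 1)
    (σk L TV : Q → ℝ)
    (hσ : ∀ q, σk q = Real.sqrt (pk q * (1 - pk q)))
    (hL : ∀ q, L q = (pπ q - pk q) / σk q)
    (hTV : ∀ q, TV q = (1/2) * ∑ o, |π q o - πk q o|) :
    ∑ q, ρ q * (pπ q - pk q) ≥
      ∑ q, ρ q * L q
        - 2 * Real.sqrt (∑ q, ρ q * ((1 - σk q) / σk q) ^ 2)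
            * Real.sqrt (∑ q, ρ q * (TV q) ^ 2) := by
  have hσ_pos : ∀ q, 0 < σk q := fun q => by
    rw [hσ]
    exact Real.sqrt_pos.2 (mul_pos (hpk0 q) (sub_pos.2 (hpk1 q)))
  have hσ_le : ∀ q, σk q ≤ 1 := fun q => by
    rw [hσ, Real.sqrt_le_iff]
    refine ⟨zero_le_one, ?_⟩
    nlinarith [sq_nonneg (pk q - 1 / 2)]
  have hp_le : ∀ q, pπ q - pk q ≤ 2 * TV q := fun q => by
    rw [hpπ, hpk, hTV, ← mul_assoc, mul_one_div_cancel two_ne_zero, one_mul]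
    refine sum_mul_sub_sum_mul_le_sum_abs_sub _ _ _ _ fun o => ?_
    rcases hr q o with h | h <;> simp [h]
  have h_gap : ∀ q, L q - (pπ q - pk q) ≤ 2 * ((1 - σk q) / σk q * TV q) := fun q => by
    have h_eq : L q - (pπ q - pk q) = (1 - σk q) / σk q * (pπ q - pk q) := by
      rw [hL]
      field_simp [(hσ_pos q).ne']
    rw [h_eq, mul_left_comm]
    exact mul_le_mul_of_nonneg_left (hp_le q)
      (div_nonneg (sub_nonneg.2 (hσ_le q)) (hσ_pos q).le)
  have h_sum : ∑ q, ρ q * L q - ∑ q, ρ q * (pπ q - pk q) ≤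
      2 * ∑ q, ρ q * ((1 - σk q) / σk q * TV q) := by
    rw [← sum_sub_distrib, mul_sum]
    refine sum_le_sum fun q _ => ?_
    rw [← mul_sub, mul_left_comm]
    exact mul_le_mul_of_nonneg_left (h_gap q) (hρ0 q)
  have h_cs := sum_weight_mul_le_sqrt_mul_sqrt univ ρ (fun q => (1 - σk q) / σk q) TV hρ0
  linarith
end

section
/- Let O be a finite nonempty type, r : O → ℝ a reward taking values in {0,1}, π_ref a probability mass function on O with π_ref(o) > 0 for all o, β > 0, and p ∈ (0,1). Define w⁺ = √((1 − p)/p), w⁻ = √(p/(1 − p)), and the probability mass function π*(o) = π_ref(o)·exp((1/β)(w⁺·𝟙[r(o)=1] − w⁻·𝟙[r(o)=0]))/Z, where Z = ∑_o π_ref(o)·exp((1/β)(w⁺·𝟙[r(o)=1] − w⁻·𝟙[r(o)=0])). Then for every probability mass function π on O, the objective J(π) = ∑_o π(o)·(r(o) − p)/√(p(1 − p)) − β·∑_o π(o)·log(π(o)/π_ref(o)) satisfies J(π) ≤ J(π*), where terms with π(o) = 0 in the sum ∑_o π(o)·log(π(o)/π_ref(o)) are taken to be 0. -/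
open Finset

/-- **Gibbs variational inequality**: the entropy-regularized linear functional is at most the
log-partition function on probability vectors. -/
theorem sum_mul_sub_sum_mul_log_div_le {O : Type*} [Fintype O] [Nonempty O]
    (q a : O → ℝ) (hq : ∀ o, 0 < q o) (π : O → ℝ) (hπ : ∀ o, 0 ≤ π o) (hπ1 : ∑ o, π o = 1) :
    ∑ o, π o * a o - ∑ o, π o * Real.log (π o / q o)
      ≤ Real.log (∑ o, q o * Real.exp (a o)) := by
  set Z := ∑ o, q o * Real.exp (a o) with hZ
  have hZpos : 0 < Z :=
    Finset.sum_pos (fun o _ => mul_pos (hq o) (Real.exp_pos _)) Finset.univ_nonempty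
  have key : ∀ o, π o * a o - π o * Real.log (π o / q o)
      ≤ π o * Real.log Z + q o * Real.exp (a o) / Z - π o := by
    intro o
    have hs : 0 < q o * Real.exp (a o) / Z := div_pos (mul_pos (hq o) (Real.exp_pos _)) hZpos
    rcases (hπ o).eq_or_lt with h | h
    · simpa [← h] using hs.le
    · have hlog := Real.log_le_sub_one_of_pos (div_pos hs h)
      rw [Real.log_div hs.ne' h.ne',
        Real.log_div (mul_pos (hq o) (Real.exp_pos _)).ne' hZpos.ne',
        Real.log_mul (hq o).ne' (Real.exp_pos _).ne', Real.log_exp] at hlog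
      rw [Real.log_div h.ne' (hq o).ne']
      have hmul := mul_le_mul_of_nonneg_left hlog h.le
      rw [mul_sub (π o) (_ / π o), mul_div_cancel₀ _ h.ne'] at hmul
      linarith
  calc ∑ o, π o * a o - ∑ o, π o * Real.log (π o / q o)
      ≤ ∑ o, (π o * Real.log Z + q o * Real.exp (a o) / Z - π o) := by
        rw [← Finset.sum_sub_distrib]
        exact Finset.sum_le_sum fun o _ => key o
    _ = Real.log Z := by
        rw [Finset.sum_sub_distrib, Finset.sum_add_distrib, ← Finset.sum_mul, ← Finset.sum_div,
          ← hZ, hπ1, div_self hZpos.ne']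
        ring

/-- The exponential tilting of `q` by `a` attains the Gibbs variational bound. -/
theorem sum_mul_sub_sum_mul_log_div_tilt {O : Type*} [Fintype O] [Nonempty O]
    (q a : O → ℝ) (hq : ∀ o, 0 < q o) (π : O → ℝ)
    (hπ : ∀ o, π o = q o * Real.exp (a o) / ∑ o, q o * Real.exp (a o)) :
    ∑ o, π o * a o - ∑ o, π o * Real.log (π o / q o)
      = Real.log (∑ o, q o * Real.exp (a o)) := by
  set Z := ∑ o, q o * Real.exp (a o) with hZ
  have hZpos : 0 < Z :=
    Finset.sum_pos (fun o _ => mul_pos (hq o) (Real.exp_pos _)) Finset.univ_nonempty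
  have hlog : ∀ o, Real.log (π o / q o) = a o - Real.log Z := by
    intro o
    have hdiv : π o / q o = Real.exp (a o) / Z := by
      have := (hq o).ne'
      rw [hπ]
      field_simp
    rw [hdiv, Real.log_div (Real.exp_pos _).ne' hZpos.ne', Real.log_exp]
  have hsum : ∑ o, π o = 1 := by
    simp_rw [hπ]
    rw [← Finset.sum_div, ← hZ, div_self hZpos.ne']
  simp_rw [hlog, mul_sub]
  rw [Finset.sum_sub_distrib, ← Finset.sum_mul, hsum]
  ring

/-- The advantage of a binary reward, standardized by its Bernoulli standard deviation. -/
theorem standardized_binary_reward (p x : ℝ) (hp0 : 0 < p) (hp1 : p < 1) (hx : x = 0 ∨ x = 1) :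
    (x - p) / Real.sqrt (p * (1 - p))
      = Real.sqrt ((1 - p) / p) * (if x = 1 then 1 else 0)
        - Real.sqrt (p / (1 - p)) * (if x = 0 then 1 else 0) := by
  have hq : 0 < 1 - p := sub_pos.2 hp1
  have hsp := Real.sqrt_pos.2 hp0
  have hsq := Real.sqrt_pos.2 hq
  have hp2 := Real.sq_sqrt hp0.le
  have hq2 := Real.sq_sqrt hq.le
  rw [Real.sqrt_mul hp0.le, Real.sqrt_div hq.le, Real.sqrt_div hp0.le]
  rcases hx with rfl | rfl
  · simp only [zero_ne_one, if_false, if_true]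
    field_simp
    linarith
  · simp only [one_ne_zero, if_false, if_true]
    field_simp
    linarith

theorem grpo_closed_form_update
    (O : Type*) [Fintype O] [Nonempty O]
    (r : O → ℝ) (hr : ∀ o, r o = 0 ∨ r o = 1)
    (πref : O → ℝ) (hπref : ∀ o, 0 < πref o) (hπref1 : ∑ o, πref o = 1)
    (β : ℝ) (hβ : 0 < β) (p : ℝ) (hp0 : 0 < p) (hp1 : p < 1)
    (wp wm Z : ℝ) (πs : O → ℝ)
    (hwp : wp = Real.sqrt ((1 - p) / p)) (hwm : wm = Real.sqrt (p / (1 - p)))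
    (hZ : Z = ∑ o, πref o *
      Real.exp ((1/β) * (wp * (if r o = 1 then 1 else 0) - wm * (if r o = 0 then 1 else 0))))
    (hπs : ∀ o, πs o = πref o *
      Real.exp ((1/β) * (wp * (if r o = 1 then 1 else 0) - wm * (if r o = 0 then 1 else 0))) / Z)
    (J : (O → ℝ) → ℝ)
    (hJ : ∀ π : O → ℝ,
      J π = ∑ o, π o * (r o - p) / Real.sqrt (p * (1 - p))
            - β * ∑ o, π o * Real.log (π o / πref o)) :
    ∀ π : O → ℝ, (∀ o, 0 ≤ π o) → ∑ o, π o = 1 → J π ≤ J πs := by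
  intro π hπ hπ1
  set a : O → ℝ := fun o =>
    (1/β) * (wp * (if r o = 1 then 1 else 0) - wm * (if r o = 0 then 1 else 0)) with ha
  have hJ' : ∀ ρ : O → ℝ,
      J ρ = β * (∑ o, ρ o * a o - ∑ o, ρ o * Real.log (ρ o / πref o)) := by
    intro ρ
    rw [hJ, mul_sub β, Finset.mul_sum (f := fun o => ρ o * a o)]
    congr 1
    refine Finset.sum_congr rfl fun o _ => ?_
    rw [mul_div_assoc, standardized_binary_reward p (r o) hp0 hp1 (hr o), ← hwp, ← hwm, ha]
    field_simp
  rw [hJ', hJ']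
  refine mul_le_mul_of_nonneg_left ?_ hβ.le
  rw [sum_mul_sub_sum_mul_log_div_tilt πref a hπref πs (fun o => by rw [hπs o, hZ])]
  exact sum_mul_sub_sum_mul_log_div_le πref a hπref π hπ hπ1
end

section
/- Let O be a finite nonempty type, r : O → ℝ a reward taking values in {0,1}, π_ref a probability mass function on O with π_ref(o) > 0 for all o, β > 0, and p ∈ (0,1). Set p_ref = ∑_o π_ref(o)·r(o) and assume 0 < p_ref < 1. Define w⁺ = √((1 − p)/p), w⁻ = √(p/(1 − p)), and π*(o) = π_ref(o)·exp((1/β)(w⁺·𝟙[r(o)=1] − w⁻·𝟙[r(o)=0]))/Z with Z = ∑_o π_ref(o)·exp((1/β)(w⁺·𝟙[r(o)=1] − w⁻·𝟙[r(o)=0])). Then ∑_o π*(o)·r(o) = 1/(1 + ((1 − p_ref)/p_ref)·exp(−1/(β·√(p(1 − p))))). -/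
open Finset

theorem sqrt_odds_add_sqrt_odds_inv {p : ℝ} (hp0 : 0 < p) (hp1 : p < 1) :
    Real.sqrt ((1 - p) / p) + Real.sqrt (p / (1 - p)) = 1 / Real.sqrt (p * (1 - p)) := by
  have hq : 0 < 1 - p := by linarith
  have ha : 0 < Real.sqrt p := Real.sqrt_pos.2 hp0
  have hb : 0 < Real.sqrt (1 - p) := Real.sqrt_pos.2 hq
  rw [Real.sqrt_div hq.le, Real.sqrt_div hp0.le, Real.sqrt_mul hp0.le]
  field_simp
  rw [Real.sq_sqrt hp0.le, Real.sq_sqrt hq.le]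
  ring

theorem grpo_recursion
    (O : Type*) [Fintype O] [Nonempty O]
    (r : O → ℝ) (hr : ∀ o, r o = 0 ∨ r o = 1)
    (πref : O → ℝ) (hπref : ∀ o, 0 < πref o) (hπref1 : ∑ o, πref o = 1)
    (β : ℝ) (hβ : 0 < β) (p : ℝ) (hp0 : 0 < p) (hp1 : p < 1)
    (pref : ℝ) (hpref : pref = ∑ o, πref o * r o)
    (hpref0 : 0 < pref) (hpref1 : pref < 1)
    (wp wm Z : ℝ) (πs : O → ℝ)
    (hwp : wp = Real.sqrt ((1 - p) / p)) (hwm : wm = Real.sqrt (p / (1 - p)))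
    (hZ : Z = ∑ o, πref o *
      Real.exp ((1/β) * (wp * (if r o = 1 then 1 else 0) - wm * (if r o = 0 then 1 else 0))))
    (hπs : ∀ o, πs o = πref o *
      Real.exp ((1/β) * (wp * (if r o = 1 then 1 else 0) - wm * (if r o = 0 then 1 else 0))) / Z) :
    ∑ o, πs o * r o =
      1 / (1 + ((1 - pref) / pref) * Real.exp (-1 / (β * Real.sqrt (p * (1 - p))))) := by
  have htilt : ∀ o, Real.exp ((1/β) *
      (wp * (if r o = 1 then 1 else 0) - wm * (if r o = 0 then 1 else 0))) =
      r o * Real.exp (wp / β) + (1 - r o) * Real.exp (-wm / β) := by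
    intro o
    rcases hr o with h | h <;> simp [h] <;> ring
  have hZ' : Z = pref * Real.exp (wp / β) + (1 - pref) * Real.exp (-wm / β) := by
    have hfail : 1 - pref = ∑ o, πref o * (1 - r o) := by
      simp_rw [mul_sub, mul_one, Finset.sum_sub_distrib, hπref1, hpref]
    rw [hZ, hfail, hpref, Finset.sum_mul, Finset.sum_mul, ← Finset.sum_add_distrib]
    refine Finset.sum_congr rfl fun o _ => ?_
    rw [htilt]
    ring
  have hsum : ∑ o, πs o * r o = pref * Real.exp (wp / β) / Z := by
    rw [hpref, Finset.sum_mul, Finset.sum_div]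
    refine Finset.sum_congr rfl fun o _ => ?_
    rw [hπs, htilt]
    rcases hr o with h | h <;> simp [h]
  have hexp : Real.exp (-wm / β) =
      Real.exp (wp / β) * Real.exp (-1 / (β * Real.sqrt (p * (1 - p)))) := by
    have h := sqrt_odds_add_sqrt_odds_inv hp0 hp1
    rw [← hwp, ← hwm] at h
    have hdiv : -1 / (β * Real.sqrt (p * (1 - p))) = -(wp + wm) / β := by
      rw [h, neg_div, neg_div, div_div, mul_comm β]
    rw [← Real.exp_add, hdiv]
    congr 1
    ring
  have hq : 0 < 1 - pref := by linarith
  rw [hsum, hZ', hexp]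
  have hA := Real.exp_pos (wp / β)
  have hE := Real.exp_pos (-1 / (β * Real.sqrt (p * (1 - p))))
  generalize Real.exp (wp / β) = A at *
  generalize Real.exp (-1 / (β * Real.sqrt (p * (1 - p)))) = E at *
  field_simp
end

section
/- Let β > 0, ε > 0, and p_ref ∈ (0,1). Define h(p) = 1/(1 + ((1 − p_ref)/p_ref)·exp(−1/(β·√(p(1 − p) + ε)))). Then for every p ∈ [0,1], h(p) > p_ref. -/
theorem grpo_monotonic_improvement
    (β ε pref : ℝ) (hβ : 0 < β) (hε : 0 < ε) (hpref0 : 0 < pref) (hpref1 : pref < 1)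
    (h : ℝ → ℝ)
    (hh : ∀ p, h p = 1 / (1 + ((1 - pref) / pref) *
      Real.exp (-1 / (β * Real.sqrt (p * (1 - p) + ε))))) :
    ∀ p, 0 ≤ p → p ≤ 1 → h p > pref := by
  intro p hp0 hp1
  have hvar : 0 < p * (1 - p) + ε :=
    add_pos_of_nonneg_of_pos (mul_nonneg hp0 (sub_nonneg.2 hp1)) hε
  have hexp : Real.exp (-1 / (β * Real.sqrt (p * (1 - p) + ε))) < 1 :=
    Real.exp_lt_one_iff.2 (div_neg_of_neg_of_pos (by norm_num) (mul_pos hβ (Real.sqrt_pos.2 hvar)))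
  have hodds : 0 < (1 - pref) / pref := div_pos (sub_pos.2 hpref1) hpref0
  rw [hh, gt_iff_lt, lt_div_iff₀ (by positivity)]
  calc pref * (1 + (1 - pref) / pref * Real.exp (-1 / (β * Real.sqrt (p * (1 - p) + ε))))
      < pref * (1 + (1 - pref) / pref * 1) := by gcongr
    _ = 1 := by field_simp; ring
end

section
/- Let O be a finite nonempty type, r : O → ℝ a reward taking values in {0,1}, π and π_k probability mass functions on O, and ρ⁺, ρ⁻ ∈ [0,1] with ρ⁺ + ρ⁻ < 1. Let ξ be uniformly distributed on [0,1] and r̃(o,ξ) = (1 − r(o))·𝟙[ξ ≤ ρ⁺] + r(o)·𝟙[ξ ≤ 1 − ρ⁻]. Set p_π = ∑_o π(o)·r(o), p_k = ∑_o π_k(o)·r(o), μ_k = ρ⁺ + (1 − ρ⁺ − ρ⁻)·p_k, and assume 0 < μ_k < 1; set σ̃_k = √(μ_k(1 − μ_k)). Then the noisy surrogate L̃ = (∑_o π(o)·∫₀¹ r̃(o,ξ) dξ − ∑_o π_k(o)·∫₀¹ r̃(o,ξ) dξ)/σ̃_k satisfies L̃ = (1 − ρ⁺ − ρ⁻)·(p_π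 − p_k)/σ̃_k. -/
open Finset

theorem intervalIntegrable_ite_le (c a b : ℝ) :
    IntervalIntegrable (fun ξ : ℝ => if ξ ≤ c then (1 : ℝ) else 0) MeasureTheory.volume a b := by
  apply Antitone.intervalIntegrable
  intro x y hxy
  dsimp only
  split_ifs <;> linarith

theorem integral_ite_le {c : ℝ} (h0 : 0 ≤ c) (h1 : c ≤ 1) :
    ∫ ξ in (0 : ℝ)..1, (if ξ ≤ c then (1 : ℝ) else 0) = c := by
  have h := intervalIntegral.integral_indicator (μ := MeasureTheory.volume)
    (f := fun _ : ℝ => (1 : ℝ)) (Set.mem_Icc.2 ⟨h0, h1⟩)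
  simpa [Set.indicator_apply] using h

theorem sum_mul_affine {O : Type*} [Fintype O] (r p : O → ℝ) (hp : ∑ o, p o = 1) (a b : ℝ) :
    ∑ o, p o * (a + b * r o) = a + b * ∑ o, p o * r o := by
  simp only [mul_add, sum_add_distrib, ← sum_mul, hp, one_mul, mul_sum, mul_left_comm]

theorem noisy_surrogate_attenuation
    (O : Type*) [Fintype O] [Nonempty O]
    (r : O → ℝ) (hr : ∀ o, r o = 0 ∨ r o = 1)
    (π πk : O → ℝ)
    (hπ0 : ∀ o, 0 ≤ π o) (hπ1 : ∑ o, π o = 1)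
    (hπk0 : ∀ o, 0 ≤ πk o) (hπk1 : ∑ o, πk o = 1)
    (ρp ρm : ℝ) (hρp0 : 0 ≤ ρp) (hρp1 : ρp ≤ 1) (hρm0 : 0 ≤ ρm) (hρm1 : ρm ≤ 1)
    (hsum : ρp + ρm < 1)
    (rt : O → ℝ → ℝ)
    (hrt : ∀ o ξ, rt o ξ =
      (1 - r o) * (if ξ ≤ ρp then 1 else 0) + r o * (if ξ ≤ 1 - ρm then 1 else 0))
    (pπ pk μk σt L : ℝ)
    (hpπ : pπ = ∑ o, π o * r o) (hpk : pk = ∑ o, πk o * r o)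
    (hμk : μk = ρp + (1 - ρp - ρm) * pk) (hμk0 : 0 < μk) (hμk1 : μk < 1)
    (hσt : σt = Real.sqrt (μk * (1 - μk)))
    (hL : L = ((∑ o, π o * ∫ ξ in (0:ℝ)..1, rt o ξ)
              - (∑ o, πk o * ∫ ξ in (0:ℝ)..1, rt o ξ)) / σt) :
    L = (1 - ρp - ρm) * (pπ - pk) / σt := by
  have hint : ∀ o, ∫ ξ in (0 : ℝ)..1, rt o ξ = ρp + (1 - ρp - ρm) * r o := by
    intro o
    simp only [hrt]
    rw [intervalIntegral.integral_add ((intervalIntegrable_ite_le _ _ _).const_mul _)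
      ((intervalIntegrable_ite_le _ _ _).const_mul _), intervalIntegral.integral_const_mul,
      intervalIntegral.integral_const_mul, integral_ite_le hρp0 hρp1,
      integral_ite_le (by linarith) (by linarith)]
    ring
  simp only [hL, hint, sum_mul_affine r _ hπ1, sum_mul_affine r _ hπk1, hpπ, hpk]
  ring
end

section
/- Let β > 0, ε > 0, p_ref ∈ (0,1), and ρ⁺, ρ⁻ ≥ 0 with 0 < ρ⁺ + ρ⁻ < 1; set s = 1 − ρ⁺ − ρ⁻ and F(p) = ρ⁺ + s·p. Define h(p) = 1/(1 + ((1 − p_ref)/p_ref)·exp(−1/(β·√(p(1 − p) + ε)))) and h̃(p) = 1/(1 + ((1 − p_ref)/p_ref)·exp(−s/(β·√(F(p)(1 − F(p)) + ε)))). Then for every p ∈ [0,1], h̃(p) < h(p). -/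
theorem noisy_recursion_dominated
    (β ε pref ρp ρm : ℝ) (hβ : 0 < β) (hε : 0 < ε)
    (hpref0 : 0 < pref) (hpref1 : pref < 1)
    (hρp : 0 ≤ ρp) (hρm : 0 ≤ ρm) (hsum0 : 0 < ρp + ρm) (hsum1 : ρp + ρm < 1)
    (s : ℝ) (hs : s = 1 - ρp - ρm)
    (F : ℝ → ℝ) (hF : ∀ p, F p = ρp + s * p)
    (h ht : ℝ → ℝ)
    (hh : ∀ p, h p = 1 / (1 + ((1 - pref) / pref) *
      Real.exp (-1 / (β * Real.sqrt (p * (1 - p) + ε)))))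
    (hht : ∀ p, ht p = 1 / (1 + ((1 - pref) / pref) *
      Real.exp (-s / (β * Real.sqrt (F p * (1 - F p) + ε))))) :
    ∀ p, 0 ≤ p → p ≤ 1 → ht p < h p := by
  intro p hp0 hp1
  have hs0 : 0 < s := by linarith
  have hs1 : s < 1 := by linarith
  have hq : 0 ≤ 1 - p := by linarith
  have hA : 0 < p * (1 - p) + ε := by positivity
  have hvar : s ^ 2 * (p * (1 - p) + ε) < F p * (1 - F p) + ε := by
    have hF1 : 1 - F p = ρm + s * (1 - p) := by rw [hF, hs]; ring
    rw [hF1, hF]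
    have hcross : 0 ≤ ρp * ρm + ρp * (s * (1 - p)) + s * p * ρm := by positivity
    have hsε : s ^ 2 * ε < ε := mul_lt_of_lt_one_left hε (by nlinarith)
    linarith
  have hB : 0 < F p * (1 - F p) + ε := lt_trans (by positivity) hvar
  have hsqrt : s * √(p * (1 - p) + ε) < √(F p * (1 - F p) + ε) := by
    apply Real.lt_sqrt_of_sq_lt
    rwa [mul_pow, Real.sq_sqrt hA.le]
  have hsA := Real.sqrt_pos.2 hA
  have hsB := Real.sqrt_pos.2 hB
  have hexp : -1 / (β * √(p * (1 - p) + ε)) < -s / (β * √(F p * (1 - F p) + ε)) := by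
    rw [div_lt_div_iff₀ (by positivity) (by positivity)]
    linarith [mul_lt_mul_of_pos_left hsqrt hβ]
  have hodds : 0 < (1 - pref) / pref := div_pos (by linarith) hpref0
  rw [hh, hht]
  gcongr
end

section
/- Let β > 0, ε > 0, p_ref ∈ (0,1), and ρ⁺, ρ⁻ ≥ 0 with s := 1 − ρ⁺ − ρ⁻ > 0; set F(p) = ρ⁺ + s·p. Define h̃(p) = 1/(1 + ((1 − p_ref)/p_ref)·exp(−s/(β·√(F(p)(1 − F(p)) + ε)))). Then for every p ∈ [0,1], h̃(p) > p_ref. -/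
theorem noisy_monotonic_improvement
    (β ε pref ρp ρm : ℝ) (hβ : 0 < β) (hε : 0 < ε)
    (hpref0 : 0 < pref) (hpref1 : pref < 1)
    (hρp : 0 ≤ ρp) (hρm : 0 ≤ ρm)
    (s : ℝ) (hs : s = 1 - ρp - ρm) (hspos : 0 < s)
    (F : ℝ → ℝ) (hF : ∀ p, F p = ρp + s * p)
    (ht : ℝ → ℝ)
    (hht : ∀ p, ht p = 1 / (1 + ((1 - pref) / pref) *
      Real.exp (-s / (β * Real.sqrt (F p * (1 - F p) + ε))))) :
    ∀ p, 0 ≤ p → p ≤ 1 → ht p > pref := by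
  intro p hp0 hp1
  have hF0 : 0 ≤ F p := by rw [hF]; positivity
  have hF1 : F p ≤ 1 := by
    rw [hF]
    linarith [mul_le_of_le_one_right hspos.le hp1]
  have hvar : 0 < F p * (1 - F p) + ε :=
    add_pos_of_nonneg_of_pos (mul_nonneg hF0 (sub_nonneg.2 hF1)) hε
  have hexp : Real.exp (-s / (β * Real.sqrt (F p * (1 - F p) + ε))) < 1 :=
    Real.exp_lt_one_iff.2
      (div_neg_of_neg_of_pos (neg_neg_of_pos hspos) (mul_pos hβ (Real.sqrt_pos.2 hvar)))
  have hodds : 0 < (1 - pref) / pref := div_pos (sub_pos.2 hpref1) hpref0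
  rw [hht, gt_iff_lt, lt_one_div hpref0 (by positivity)]
  calc
    _ < 1 + (1 - pref) / pref * 1 := by gcongr
    _ = 1 / pref := by field_simp; ring
end

section
/- Let Q be a finite nonempty type with probability mass function ρ : Q → ℝ, O a finite nonempty type, and r : Q → O → ℝ a reward taking values in {0,1}. Let π, π_k assign to each q a probability mass function on O, with p_π(q) = ∑_o π(q)(o)·r(q)(o) and p_k(q) = ∑_o π_k(q)(o)·r(q)(o). Let M : Q → ℝ satisfy M(q) > 0 for all q, and define L(q) = (p_π(q) − p_k(q))/M(q) and TV(q) = (1/2)·∑_o |π(q)(o) − π_k(q)(o)|. Then ∑_q ρ(q)(p_π(q) − p_k(q)) ≥ ∑_q ρ(q)·L(q) − 2·√(∑_q ρ(q)·((1 − M(q))/M(q))²)·√(∑_q ρ(q)·TV(q)²). -/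
open Finset

theorem sum_weight_mul_mul_le_sqrt_mul_sqrt {ι : Type*} (s : Finset ι) {w : ι → ℝ}
    (hw : ∀ i, 0 ≤ w i) (a b : ι → ℝ) :
    ∑ i ∈ s, w i * (a i * b i) ≤
      Real.sqrt (∑ i ∈ s, w i * a i ^ 2) * Real.sqrt (∑ i ∈ s, w i * b i ^ 2) := by
  have h := Real.sum_mul_le_sqrt_mul_sqrt s (fun i => Real.sqrt (w i) * a i)
    (fun i => Real.sqrt (w i) * b i)
  simp only [mul_pow, Real.sq_sqrt (hw _)] at h
  refine le_of_eq_of_le (Finset.sum_congr rfl fun i _ => ?_) h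
  rw [mul_mul_mul_comm, Real.mul_self_sqrt (hw i)]

theorem abs_sum_mul_sub_sum_mul_le {ι : Type*} (s : Finset ι) (f g r : ι → ℝ)
    (hr : ∀ i, |r i| ≤ 1) :
    |∑ i ∈ s, f i * r i - ∑ i ∈ s, g i * r i| ≤ ∑ i ∈ s, |f i - g i| := by
  rw [← Finset.sum_sub_distrib]
  refine (Finset.abs_sum_le_sum_abs _ _).trans (Finset.sum_le_sum fun i _ => ?_)
  rw [← sub_mul, abs_mul]
  exact mul_le_of_le_one_right (abs_nonneg _) (hr i)

theorem generalized_grpo_policy_improvement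
    (Q O : Type*) [Fintype Q] [Nonempty Q] [Fintype O] [Nonempty O]
    (ρ : Q → ℝ) (hρ0 : ∀ q, 0 ≤ ρ q) (hρ1 : ∑ q, ρ q = 1)
    (r : Q → O → ℝ) (hr : ∀ q o, r q o = 0 ∨ r q o = 1)
    (π πk : Q → O → ℝ)
    (hπ0 : ∀ q o, 0 ≤ π q o) (hπ1 : ∀ q, ∑ o, π q o = 1)
    (hπk0 : ∀ q o, 0 ≤ πk q o) (hπk1 : ∀ q, ∑ o, πk q o = 1)
    (pπ pk : Q → ℝ)
    (hpπ : ∀ q, pπ q = ∑ o, π q o * r q o)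
    (hpk : ∀ q, pk q = ∑ o, πk q o * r q o)
    (M : Q → ℝ) (hM : ∀ q, 0 < M q)
    (L TV : Q → ℝ)
    (hL : ∀ q, L q = (pπ q - pk q) / M q)
    (hTV : ∀ q, TV q = (1/2) * ∑ o, |π q o - πk q o|) :
    ∑ q, ρ q * (pπ q - pk q) ≥
      ∑ q, ρ q * L q
        - 2 * Real.sqrt (∑ q, ρ q * ((1 - M q) / M q) ^ 2)
            * Real.sqrt (∑ q, ρ q * (TV q) ^ 2) := by
  have hgap : ∀ q, |pπ q - pk q| ≤ 2 * TV q := fun q => by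
    have h := abs_sum_mul_sub_sum_mul_le univ (π q) (πk q) (r q) fun o => by
      rcases hr q o with h | h <;> simp [h]
    rw [hpπ, hpk, hTV]
    linarith
  have hpoint : ∀ q, ρ q * L q - ρ q * (pπ q - pk q) ≤
      2 * (ρ q * (|(1 - M q) / M q| * TV q)) := fun q => by
    have hL' : L q - (pπ q - pk q) = (1 - M q) / M q * (pπ q - pk q) := by
      rw [hL]
      have := (hM q).ne'
      field_simp
    have hdiff : L q - (pπ q - pk q) ≤ |(1 - M q) / M q| * (2 * TV q) := by
      rw [hL']
      refine (le_abs_self _).trans ?_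
      rw [abs_mul]
      exact mul_le_mul_of_nonneg_left (hgap q) (abs_nonneg _)
    linarith [mul_le_mul_of_nonneg_left hdiff (hρ0 q)]
  have hsum := Finset.sum_le_sum fun q (_ : q ∈ univ) => hpoint q
  rw [Finset.sum_sub_distrib, ← Finset.mul_sum] at hsum
  have hcs := sum_weight_mul_mul_le_sqrt_mul_sqrt univ hρ0 (fun q => |(1 - M q) / M q|) TV
  simp only [sq_abs] at hcs
  linarith
end

section
/- Let O be a finite nonempty type, π a probability mass function on O, r : O → ℝ a reward taking values in {0,1}, and ρ⁺, ρ⁻ ∈ [0,1] with s := 1 − ρ⁺ − ρ⁻ > 0. Let ξ be uniformly distributed on [0,1], r̃(o,ξ) = (1 − r(o))·𝟙[ξ ≤ ρ⁺] + r(o)·𝟙[ξ ≤ 1 − ρ⁻], and r̂(o,ξ) = (r̃(o,ξ) − ρ⁺)/s. Set p = ∑_o π(o)·r(o). Then the variance of r̂ under the joint law of o ~ π and ξ uniform on [0,1] equals (p·ρ⁻(1 − ρ⁻) + (1 − p)·ρ⁺(1 − ρ⁺))/s² + p(1 − p). -/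
open Finset

/-- The integral over the unit interval of a step function with a single jump at `c`. -/
theorem integral_ite_le_unitInterval {c : ℝ} (hc0 : 0 ≤ c) (hc1 : c ≤ 1) (A B : ℝ) :
    ∫ ξ in (0:ℝ)..1, (if ξ ≤ c then A else B) = c * A + (1 - c) * B := by
  have hleft : Set.EqOn (fun _ => A) (fun ξ : ℝ => if ξ ≤ c then A else B) (Set.uIoc 0 c) := by
    intro ξ hξ
    rw [Set.uIoc_of_le hc0] at hξ
    simp [hξ.2]
  have hright : Set.EqOn (fun _ => B) (fun ξ : ℝ => if ξ ≤ c then A else B) (Set.uIoc c 1) := by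
    intro ξ hξ
    rw [Set.uIoc_of_le hc1] at hξ
    simp [hξ.1]
  rw [← intervalIntegral.integral_add_adjacent_intervals
      ((intervalIntegrable_const (c := A)).congr hleft)
      ((intervalIntegrable_const (c := B)).congr hright),
    ← intervalIntegral.integral_congr_ae (.of_forall hleft),
    ← intervalIntegral.integral_congr_ae (.of_forall hright)]
  simp

theorem corrected_reward_variance
    (O : Type*) [Fintype O] [Nonempty O]
    (π : O → ℝ) (hπ0 : ∀ o, 0 ≤ π o) (hπ1 : ∑ o, π o = 1)
    (r : O → ℝ) (hr : ∀ o, r o = 0 ∨ r o = 1)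
    (ρp ρm : ℝ) (hρp0 : 0 ≤ ρp) (hρp1 : ρp ≤ 1) (hρm0 : 0 ≤ ρm) (hρm1 : ρm ≤ 1)
    (s : ℝ) (hs : s = 1 - ρp - ρm) (hspos : 0 < s)
    (rt rc : O → ℝ → ℝ)
    (hrt : ∀ o ξ, rt o ξ =
      (1 - r o) * (if ξ ≤ ρp then 1 else 0) + r o * (if ξ ≤ 1 - ρm then 1 else 0))
    (hrc : ∀ o ξ, rc o ξ = (rt o ξ - ρp) / s)
    (p : ℝ) (hp : p = ∑ o, π o * r o) :
    (∑ o, π o * ∫ ξ in (0:ℝ)..1, (rc o ξ - p) ^ 2) =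
      (p * ρm * (1 - ρm) + (1 - p) * ρp * (1 - ρp)) / s ^ 2 + p * (1 - p) := by
  have hs0 : s ≠ 0 := hspos.ne'
  have hinner (o : O) : ∫ ξ in (0:ℝ)..1, (rc o ξ - p) ^ 2 =
      (ρp * (1 - ρp) / s ^ 2 + p ^ 2) +
        r o * (ρm * (1 - ρm) / s ^ 2 + (1 - p) ^ 2 - (ρp * (1 - ρp) / s ^ 2 + p ^ 2)) := by
    rcases hr o with h | h
    · have hstep (ξ : ℝ) : (rc o ξ - p) ^ 2 =
          if ξ ≤ ρp then ((1 - ρp) / s - p) ^ 2 else (-ρp / s - p) ^ 2 := by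
        rw [hrc, hrt, h]
        split_ifs <;> ring
      simp_rw [hstep]
      rw [integral_ite_le_unitInterval hρp0 hρp1, h]
      field_simp
      ring
    · have hstep (ξ : ℝ) : (rc o ξ - p) ^ 2 =
          if ξ ≤ 1 - ρm then ((1 - ρp) / s - p) ^ 2 else (-ρp / s - p) ^ 2 := by
        rw [hrc, hrt, h]
        split_ifs <;> ring
      simp_rw [hstep]
      rw [integral_ite_le_unitInterval (by linarith) (by linarith), h]
      field_simp
      rw [hs]
      ring
  simp_rw [hinner, mul_add, ← mul_assoc, sum_add_distrib, ← sum_mul, hπ1, ← hp]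
  field_simp
  ring
end

section
/- Let O be a finite nonempty type, π a probability mass function on O, r : O → ℝ a reward taking values in {0,1}, and ρ⁺, ρ⁻ ∈ [0,1] with s := 1 − ρ⁺ − ρ⁻ > 0. Let n ≥ 2 and let (o_1,ξ_1),…,(o_n,ξ_n) be i.i.d. with each o_i ~ π and each ξ_i uniform on [0,1], all independent. Define r̂_i = (r̃(o_i,ξ_i) − ρ⁺)/s where r̃(o,ξ) = (1 − r(o))·𝟙[ξ ≤ ρ⁺] + r(o)·𝟙[ξ ≤ 1 − ρ⁻], the sample mean r̄ = (1/n)·∑_{i=1}^n r̂_i, the sample variance V̂ = (1/(n−1))·∑_{i=1}^n (r̂_i − r̄)², and Z = V̂ − r̄·ρ⁻(1 − ρ⁻)/s² − (1 − r̄)·ρ⁺(1 − ρ⁺)/s². Then, with p = ∑_o π(o)·r(o), the expectation of Z equals p(1 − p). -/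
open Finset MeasureTheory

theorem sum_prod_mul_integral_pi_prod {ι O Ω : Type*} [Fintype ι] [DecidableEq ι]
    [Fintype O] [MeasurableSpace Ω] (μ : Measure Ω) [SigmaFinite μ] (w : O → ℝ) (F : ι → O → Ω → ℝ) :
    ∑ o : ι → O, (∏ i, w (o i)) * ∫ ξ : ι → Ω, ∏ i, F i (o i) (ξ i) ∂(Measure.pi fun _ => μ) =
      ∏ i, ∑ a, w a * ∫ t, F i a t ∂μ := by
  rw [Finset.prod_univ_sum, Fintype.piFinset_univ]
  refine Finset.sum_congr rfl fun o _ => ?_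
  rw [integral_fintype_prod_eq_prod (fun i => F i (o i)), ← Finset.prod_mul_distrib]

theorem sum_prod_mul_integral_pi_eval {ι O Ω : Type*} [Fintype ι] [DecidableEq ι]
    [Fintype O] [MeasurableSpace Ω] (μ : Measure Ω) [IsProbabilityMeasure μ] (w : O → ℝ)
    (hw : ∑ a, w a = 1) (X : O → Ω → ℝ) (i : ι) :
    ∑ o : ι → O, (∏ k, w (o k)) * ∫ ξ : ι → Ω, X (o i) (ξ i) ∂(Measure.pi fun _ => μ) =
      ∑ a, w a * ∫ t, X a t ∂μ := by
  have h := sum_prod_mul_integral_pi_prod μ w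
    (fun k a t => if k = i then X a t else 1 : ι → O → Ω → ℝ)
  simp only [Finset.prod_ite_eq', Finset.mem_univ, if_true] at h
  rw [h, Finset.prod_eq_single i (fun k _ hk => by simp [hk, hw]) (by simp)]
  simp

theorem sum_prod_mul_integral_pi_eval_mul_eval {ι O Ω : Type*} [Fintype ι] [DecidableEq ι]
    [Fintype O] [MeasurableSpace Ω] (μ : Measure Ω) [IsProbabilityMeasure μ] (w : O → ℝ)
    (hw : ∑ a, w a = 1) (X : O → Ω → ℝ) {i j : ι} (hij : i ≠ j) :
    ∑ o : ι → O, (∏ k, w (o k)) *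
        ∫ ξ : ι → Ω, X (o i) (ξ i) * X (o j) (ξ j) ∂(Measure.pi fun _ => μ) =
      (∑ a, w a * ∫ t, X a t ∂μ) ^ 2 := by
  have h := sum_prod_mul_integral_pi_prod μ w
    (fun k a t => (if k = i then X a t else 1) * (if k = j then X a t else 1) : ι → O → Ω → ℝ)
  simp only [Finset.prod_mul_distrib, Finset.prod_ite_eq', Finset.mem_univ, if_true] at h
  rw [h, Finset.prod_eq_mul i j hij (fun k _ hk => by simp [hk.1, hk.2, hw]) (by simp) (by simp)]
  simp [hij, hij.symm, sq]

theorem sum_sub_mean_sq {n : ℕ} (hn : n ≠ 0) (x : Fin n → ℝ) :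
    ∑ i, (x i - 1 / (n : ℝ) * ∑ j, x j) ^ 2 =
      ∑ i, x i ^ 2 - 1 / (n : ℝ) * ∑ i, ∑ j, x i * x j := by
  have hn' : (n : ℝ) ≠ 0 := Nat.cast_ne_zero.mpr hn
  rw [← Finset.sum_mul_sum]
  simp only [sub_sq, Finset.sum_add_distrib, Finset.sum_sub_distrib, ← Finset.sum_mul,
    ← Finset.mul_sum, Finset.sum_const, Finset.card_univ, Fintype.card_fin, nsmul_eq_mul]
  field_simp
  ring

/-- Expectation of an affine combination of the sample variance and the sample mean of an i.i.d.
sample of `X o t`, with `o` of weight `w o` and `t` of law `μ`. -/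
theorem sum_prod_mul_integral_pi_sampleVariance {O Ω : Type*} [Fintype O]
    [MeasurableSpace Ω] (μ : Measure Ω) [IsProbabilityMeasure μ] (w : O → ℝ)
    (hw : ∑ a, w a = 1) (X : O → Ω → ℝ) (hX : ∀ a, MemLp (X a) 2 μ) {n : ℕ} (hn : 2 ≤ n)
    (b c : ℝ) :
    ∑ o : Fin n → O, (∏ k, w (o k)) * ∫ ξ : Fin n → Ω,
        (1 / ((n : ℝ) - 1) *
            ∑ i, (X (o i) (ξ i) - 1 / (n : ℝ) * ∑ j, X (o j) (ξ j)) ^ 2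
          + b * (1 / (n : ℝ) * ∑ i, X (o i) (ξ i)) + c) ∂(Measure.pi fun _ => μ) =
      (∑ a, w a * ∫ t, X a t ^ 2 ∂μ) - (∑ a, w a * ∫ t, X a t ∂μ) ^ 2
        + b * (∑ a, w a * ∫ t, X a t ∂μ) + c := by
  set P : Measure (Fin n → Ω) := Measure.pi fun _ => μ
  set m := ∑ a, w a * ∫ t, X a t ∂μ
  set q := ∑ a, w a * ∫ t, X a t ^ 2 ∂μ
  have hL (o : Fin n → O) (i : Fin n) : MemLp (fun ξ : Fin n → Ω => X (o i) (ξ i)) 2 P :=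
    (hX (o i)).comp_measurePreserving (measurePreserving_eval (fun _ => μ) i)
  have h1 (o : Fin n → O) (i : Fin n) : Integrable (fun ξ : Fin n → Ω => X (o i) (ξ i)) P :=
    (hL o i).integrable (by norm_num)
  have h2 (o : Fin n → O) (i : Fin n) :
      Integrable (fun ξ : Fin n → Ω => X (o i) (ξ i) ^ 2) P := (hL o i).integrable_sq
  have h3 (o : Fin n → O) (i j : Fin n) :
      Integrable (fun ξ : Fin n → Ω => X (o i) (ξ i) * X (o j) (ξ j)) P :=
    (hL o i).integrable_mul (hL o j)
  have hint (o : Fin n → O) :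
      ∫ ξ, (1 / ((n : ℝ) - 1) *
            ∑ i, (X (o i) (ξ i) - 1 / (n : ℝ) * ∑ j, X (o j) (ξ j)) ^ 2
          + b * (1 / (n : ℝ) * ∑ i, X (o i) (ξ i)) + c) ∂P =
        1 / ((n : ℝ) - 1) * (∑ i, ∫ ξ, X (o i) (ξ i) ^ 2 ∂P
          - 1 / (n : ℝ) * ∑ i, ∑ j, ∫ ξ, X (o i) (ξ i) * X (o j) (ξ j) ∂P)
        + b * (1 / (n : ℝ) * ∑ i, ∫ ξ, X (o i) (ξ i) ∂P) + c := by
    have i1 : Integrable (fun ξ : Fin n → Ω => ∑ i, X (o i) (ξ i)) P :=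
      integrable_finsetSum _ fun i _ => h1 o i
    have i2 : Integrable (fun ξ : Fin n → Ω => ∑ i, X (o i) (ξ i) ^ 2) P :=
      integrable_finsetSum _ fun i _ => h2 o i
    have i3' (i : Fin n) : Integrable (fun ξ : Fin n → Ω => ∑ j, X (o i) (ξ i) * X (o j) (ξ j)) P :=
      integrable_finsetSum _ fun j _ => h3 o i j
    have i3 : Integrable (fun ξ : Fin n → Ω => ∑ i, ∑ j, X (o i) (ξ i) * X (o j) (ξ j)) P :=
      integrable_finsetSum _ fun i _ => i3' i
    simp only [sum_sub_mean_sq (by lia : n ≠ 0)]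
    have j1 : Integrable (fun ξ : Fin n → Ω => b * (1 / (n : ℝ) * ∑ i, X (o i) (ξ i))) P :=
      (i1.const_mul _).const_mul _
    have j2 : Integrable (fun ξ : Fin n → Ω => 1 / ((n : ℝ) - 1) * (∑ i, X (o i) (ξ i) ^ 2
        - 1 / (n : ℝ) * ∑ i, ∑ j, X (o i) (ξ i) * X (o j) (ξ j))) P :=
      (i2.sub (i3.const_mul _)).const_mul _
    rw [integral_add (by exact j2.add j1) (integrable_const _), integral_add j2 j1,
      integral_const_mul, integral_sub i2 (i3.const_mul _), integral_const_mul, integral_const_mul,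
      integral_const_mul, integral_finsetSum _ fun i _ => h1 o i,
      integral_finsetSum _ fun i _ => h2 o i, integral_finsetSum _ fun i _ => i3' i]
    simp only [integral_finsetSum _ fun j _ => h3 o _ j]
    simp
  have e1 (i : Fin n) : ∑ o : Fin n → O, (∏ k, w (o k)) * ∫ ξ, X (o i) (ξ i) ∂P = m :=
    sum_prod_mul_integral_pi_eval μ w hw X i
  have e2 (i : Fin n) : ∑ o : Fin n → O, (∏ k, w (o k)) * ∫ ξ, X (o i) (ξ i) ^ 2 ∂P = q :=
    sum_prod_mul_integral_pi_eval μ w hw (fun a t => X a t ^ 2) i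
  have e3 (i j : Fin n) :
      ∑ o : Fin n → O, (∏ k, w (o k)) * ∫ ξ, X (o i) (ξ i) * X (o j) (ξ j) ∂P =
        m ^ 2 + if i = j then q - m ^ 2 else 0 := by
    split_ifs with hij
    · subst hij
      simpa only [← sq, add_sub_cancel] using e2 i
    · rw [add_zero]
      exact sum_prod_mul_integral_pi_eval_mul_eval μ w hw X hij
  have e0 : ∑ o : Fin n → O, ∏ k, w (o k) = 1 := by
    simpa [hw] using (Finset.prod_univ_sum (fun _ : Fin n => (univ : Finset O)) fun _ a => w a).symm
  have hsplit : ∑ o : Fin n → O, (∏ k, w (o k)) *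
        (1 / ((n : ℝ) - 1) * (∑ i, ∫ ξ, X (o i) (ξ i) ^ 2 ∂P
          - 1 / (n : ℝ) * ∑ i, ∑ j, ∫ ξ, X (o i) (ξ i) * X (o j) (ξ j) ∂P)
        + b * (1 / (n : ℝ) * ∑ i, ∫ ξ, X (o i) (ξ i) ∂P) + c) =
      1 / ((n : ℝ) - 1) * (∑ i, ∑ o : Fin n → O, (∏ k, w (o k)) * ∫ ξ, X (o i) (ξ i) ^ 2 ∂P
          - 1 / (n : ℝ) * ∑ i, ∑ j, ∑ o : Fin n → O, (∏ k, w (o k)) *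
              ∫ ξ, X (o i) (ξ i) * X (o j) (ξ j) ∂P)
        + b * (1 / (n : ℝ) * ∑ i, ∑ o : Fin n → O, (∏ k, w (o k)) * ∫ ξ, X (o i) (ξ i) ∂P)
        + c * ∑ o : Fin n → O, ∏ k, w (o k) := by
    simp only [Finset.sum_comm (s := (univ : Finset (Fin n))) (t := (univ : Finset (Fin n → O))),
      ← Finset.mul_sum]
    simp only [Finset.mul_sum (s := (univ : Finset (Fin n → O))), ← Finset.sum_sub_distrib,
      ← Finset.sum_add_distrib]
    exact Finset.sum_congr rfl fun o _ => by ring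
  have hn0 : (n : ℝ) ≠ 0 := by positivity
  have hn1 : (n : ℝ) - 1 ≠ 0 := by
    have : (2 : ℝ) ≤ n := by exact_mod_cast hn
    linarith
  simp only [hint, hsplit, e0, e1, e2, e3]
  simp only [Finset.sum_add_distrib, Finset.sum_ite_eq, Finset.mem_univ, if_true, Finset.sum_const,
    Finset.card_univ, Fintype.card_fin, nsmul_eq_mul]
  field_simp
  ring

theorem integral_Icc_ite_le {a : ℝ} (h0 : 0 ≤ a) (h1 : a ≤ 1) :
    ∫ t in Set.Icc (0 : ℝ) 1, (if t ≤ a then (1 : ℝ) else 0) = a := by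
  have h : (fun t : ℝ => if t ≤ a then (1 : ℝ) else 0) = (Set.Iic a).indicator 1 := by
    ext t
    simp [Set.indicator_apply]
  have hI : Set.Iic a ∩ Set.Icc 0 1 = Set.Icc 0 a := by
    ext t
    simp only [Set.mem_inter_iff, Set.mem_Iic, Set.mem_Icc]
    grind
  rw [h, integral_indicator_one measurableSet_Iic, measureReal_restrict_apply measurableSet_Iic, hI,
    Real.volume_real_Icc_of_le h0, sub_zero]

theorem variance_estimator_unbiased
    (O : Type*) [Fintype O] [Nonempty O]
    (π : O → ℝ) (hπ0 : ∀ o, 0 ≤ π o) (hπ1 : ∑ o, π o = 1)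
    (r : O → ℝ) (hr : ∀ o, r o = 0 ∨ r o = 1)
    (ρp ρm : ℝ) (hρp0 : 0 ≤ ρp) (hρp1 : ρp ≤ 1) (hρm0 : 0 ≤ ρm) (hρm1 : ρm ≤ 1)
    (s : ℝ) (hs : s = 1 - ρp - ρm) (hspos : 0 < s)
    (n : ℕ) (hn : 2 ≤ n)
    (rt : O → ℝ → ℝ)
    (hrt : ∀ o ξ, rt o ξ =
      (1 - r o) * (if ξ ≤ ρp then 1 else 0) + r o * (if ξ ≤ 1 - ρm then 1 else 0))
    (rc : O → ℝ → ℝ) (hrc : ∀ o ξ, rc o ξ = (rt o ξ - ρp) / s)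
    (rbar : (Fin n → O) → (Fin n → ℝ) → ℝ)
    (hrbar : ∀ o ξ, rbar o ξ = (1 / (n : ℝ)) * ∑ i, rc (o i) (ξ i))
    (Vhat : (Fin n → O) → (Fin n → ℝ) → ℝ)
    (hVhat : ∀ o ξ, Vhat o ξ =
      (1 / ((n : ℝ) - 1)) * ∑ i, (rc (o i) (ξ i) - rbar o ξ) ^ 2)
    (Z : (Fin n → O) → (Fin n → ℝ) → ℝ)
    (hZ : ∀ o ξ, Z o ξ = Vhat o ξ
      - rbar o ξ * ρm * (1 - ρm) / s ^ 2
      - (1 - rbar o ξ) * ρp * (1 - ρp) / s ^ 2)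
    (p : ℝ) (hp : p = ∑ o, π o * r o) :
    (∑ o : Fin n → O, (∏ i, π (o i)) *
        ∫ ξ : Fin n → ℝ, Z o ξ
          ∂(Measure.pi fun _ => volume.restrict (Set.Icc (0:ℝ) 1))) =
      p * (1 - p) := by
  have hμ : IsProbabilityMeasure (volume.restrict (Set.Icc (0 : ℝ) 1)) := ⟨by simp⟩
  -- Conditionally on the output, the corrected reward is an affine image of an indicator.
  have hform (a : O) : ∃ d, 0 ≤ d ∧ d ≤ 1 ∧ d = ρp + s * r a ∧
      d * (1 - d) = r a * (ρm * (1 - ρm)) + (1 - r a) * (ρp * (1 - ρp)) ∧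
      ∀ t, rc a t = ((if t ≤ d then 1 else 0) - ρp) / s := by
    rcases hr a with h | h
    · exact ⟨ρp, hρp0, hρp1, by simp [h], by simp [h], fun t => by simp [hrc, hrt, h]⟩
    · exact ⟨1 - ρm, by linarith, by linarith, by rw [h, hs]; ring, by rw [h]; ring,
        fun t => by simp [hrc, hrt, h]⟩
  choose d hd0 hd1 hds hdv hd using hform
  have hind (a : O) : MemLp (fun t : ℝ => if t ≤ d a then (1 : ℝ) else 0) 2
      (volume.restrict (Set.Icc (0 : ℝ) 1)) := by
    refine MemLp.of_bound (Measurable.ite measurableSet_Iic measurable_const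
      measurable_const).aestronglyMeasurable 1 (.of_forall fun t => ?_)
    split_ifs <;> simp
  have hX (a : O) : MemLp (rc a) 2 (volume.restrict (Set.Icc (0 : ℝ) 1)) := by
    rw [funext (hd a)]
    simpa only [div_eq_inv_mul, Pi.sub_apply] using
      ((hind a).sub (memLp_const ρp)).const_mul s⁻¹
  have hI (a : O) := (hind a).integrable (by norm_num)
  have hmean (a : O) : ∫ t in Set.Icc (0 : ℝ) 1, rc a t = r a := by
    simp only [hd]
    rw [integral_div, integral_sub (hI a) (integrable_const _),
      integral_Icc_ite_le (hd0 a) (hd1 a), hds]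
    simp [hspos.ne']
  have hsq (a : O) : ∫ t in Set.Icc (0 : ℝ) 1, rc a t ^ 2 =
      r a + (ρm * (1 - ρm) / s ^ 2) * r a + (ρp * (1 - ρp) / s ^ 2) * (1 - r a) := by
    have h (t : ℝ) : rc a t ^ 2 =
        (1 - 2 * ρp) / s ^ 2 * (if t ≤ d a then 1 else 0) + ρp ^ 2 / s ^ 2 := by
      rw [hd]
      split_ifs <;> ring
    have hrr : r a ^ 2 = r a := by rcases hr a with h | h <;> simp [h]
    simp only [h]
    rw [integral_add ((hI a).const_mul _) (integrable_const _), integral_const_mul,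
      integral_Icc_ite_le (hd0 a) (hd1 a)]
    simp only [integral_const, probReal_univ, one_smul]
    have h1 := hdv a
    have h2 := hds a
    field_simp
    linear_combination s ^ 2 * hrr + h1 + (d a - ρp + s * r a) * h2
  have hpm : ∑ a, π a * (1 - r a) = 1 - p := by
    simp only [mul_sub, mul_one, Finset.sum_sub_distrib, hπ1, hp]
  have hq : ∑ a, π a * (r a + (ρm * (1 - ρm) / s ^ 2) * r a
      + (ρp * (1 - ρp) / s ^ 2) * (1 - r a)) =
      p + (ρm * (1 - ρm) / s ^ 2) * p + (ρp * (1 - ρp) / s ^ 2) * (1 - p) := by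
    rw [← hpm, hp, Finset.mul_sum, Finset.mul_sum, ← Finset.sum_add_distrib,
      ← Finset.sum_add_distrib]
    exact Finset.sum_congr rfl fun a _ => by ring
  have key := sum_prod_mul_integral_pi_sampleVariance (volume.restrict (Set.Icc (0 : ℝ) 1)) π hπ1
    rc hX hn (ρp * (1 - ρp) / s ^ 2 - ρm * (1 - ρm) / s ^ 2) (-(ρp * (1 - ρp) / s ^ 2))
  simp only [hmean, hsq, hq, ← hp] at key
  have hZ' (o : Fin n → O) (ξ : Fin n → ℝ) : Z o ξ =
      1 / ((n : ℝ) - 1) * ∑ i, (rc (o i) (ξ i) - 1 / (n : ℝ) * ∑ j, rc (o j) (ξ j)) ^ 2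
        + (ρp * (1 - ρp) / s ^ 2 - ρm * (1 - ρm) / s ^ 2) * (1 / (n : ℝ) * ∑ i, rc (o i) (ξ i))
        + -(ρp * (1 - ρp) / s ^ 2) := by
    rw [hZ, hVhat, hrbar]
    ring
  simp only [hZ']
  rw [key]
  ring
end

section
/- Let O be a finite nonempty type, r : O → ℝ a reward taking values in {0,1}, π_ref a probability mass function on O with π_ref(o) > 0 for all o, β > 0, p ∈ (0,1), and ρ⁺, ρ⁻ ∈ [0,1] with s := 1 − ρ⁺ − ρ⁻ > 0. Set p_ref = ∑_o π_ref(o)·r(o) and assume 0 < p_ref < 1. Let μ = ρ⁺ + s·p, assume 0 < μ < 1, and define w̃⁺ = s(1 − p)/√(μ(1 − μ)), w̃⁻ = s·p/√(μ(1 − μ)), and π̃*(o) = π_ref(o)·exp((1/β)(w̃⁺·𝟙[r(o)=1] − w̃⁻·𝟙[r(o)=0]))/Z̃ with Z̃ = ∑_o π_ref(o)·exp((1/β)(w̃⁺·𝟙[r(o)=1] − w̃⁻·𝟙[r(o)=0])). Then ∑_o π̃*(o)·r(o) = 1/(1 + ((1 − p_ref)/p_ref)·exp(−s/(β·√(μ(1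 − μ))))). -/
open Finset

/-- Tilting a probability mass function by a factor `a` on `{r = 1}` and `b` on `{r = 0}` multiplies
the odds of success by `a / b`. -/
theorem tilted_success_probability {O : Type*} [Fintype O] {π r f : O → ℝ} {a b q : ℝ}
    (hπ : ∑ o, π o = 1) (hq : q = ∑ o, π o * r o)
    (hf : ∀ o, f o = a * r o + b * (1 - r o)) (hr : ∀ o, r o = 0 ∨ r o = 1) :
    ∑ o, π o * f o / (∑ o, π o * f o) * r o = a * q / (a * q + b * (1 - q)) := by
  have hden : ∑ o, π o * f o = a * q + b * (1 - q) := by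
    rw [hq, ← hπ, ← sum_sub_distrib, mul_sum, mul_sum, ← sum_add_distrib]
    exact sum_congr rfl fun o _ => by rw [hf]; ring
  rw [hden, hq, mul_sum, sum_div]
  refine sum_congr rfl fun o _ => ?_
  rcases hr o with h | h <;> simp [hf, h, mul_comm]

theorem noisy_recursion_closed_form
    (O : Type*) [Fintype O] [Nonempty O]
    (r : O → ℝ) (hr : ∀ o, r o = 0 ∨ r o = 1)
    (πref : O → ℝ) (hπref : ∀ o, 0 < πref o) (hπref1 : ∑ o, πref o = 1)
    (β : ℝ) (hβ : 0 < β) (p : ℝ) (hp0 : 0 < p) (hp1 : p < 1)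
    (ρp ρm : ℝ) (hρp0 : 0 ≤ ρp) (hρp1 : ρp ≤ 1) (hρm0 : 0 ≤ ρm) (hρm1 : ρm ≤ 1)
    (s : ℝ) (hs : s = 1 - ρp - ρm) (hspos : 0 < s)
    (pref : ℝ) (hpref : pref = ∑ o, πref o * r o)
    (hpref0 : 0 < pref) (hpref1 : pref < 1)
    (μ : ℝ) (hμ : μ = ρp + s * p) (hμ0 : 0 < μ) (hμ1 : μ < 1)
    (wp wm Z : ℝ) (πs : O → ℝ)
    (hwp : wp = s * (1 - p) / Real.sqrt (μ * (1 - μ)))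
    (hwm : wm = s * p / Real.sqrt (μ * (1 - μ)))
    (hZ : Z = ∑ o, πref o *
      Real.exp ((1/β) * (wp * (if r o = 1 then 1 else 0) - wm * (if r o = 0 then 1 else 0))))
    (hπs : ∀ o, πs o = πref o *
      Real.exp ((1/β) * (wp * (if r o = 1 then 1 else 0) - wm * (if r o = 0 then 1 else 0))) / Z) :
    ∑ o, πs o * r o =
      1 / (1 + ((1 - pref) / pref) * Real.exp (-s / (β * Real.sqrt (μ * (1 - μ))))) := by
  have hS : 0 < Real.sqrt (μ * (1 - μ)) := Real.sqrt_pos.2 (mul_pos hμ0 (by linarith))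
  have hf : ∀ o, Real.exp ((1/β) * (wp * (if r o = 1 then 1 else 0)
      - wm * (if r o = 0 then 1 else 0)))
      = Real.exp (wp / β) * r o + Real.exp (-wm / β) * (1 - r o) := by
    intro o
    rcases hr o with h | h <;> simp [h] <;> ring
  have hodds : Real.exp (-wm / β)
      = Real.exp (wp / β) * Real.exp (-s / (β * Real.sqrt (μ * (1 - μ)))) := by
    rw [← Real.exp_add, hwp, hwm]
    congr 1
    field_simp
    ring
  simp only [hπs, hZ]
  rw [tilted_success_probability hπref1 hpref hf hr, hodds]
  have hA := Real.exp_pos (wp / β)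
  have hE := Real.exp_pos (-s / (β * Real.sqrt (μ * (1 - μ))))
  have hq : 0 < 1 - pref := sub_pos.2 hpref1
  generalize Real.exp (wp / β) = A at *
  generalize Real.exp (-s / (β * Real.sqrt (μ * (1 - μ)))) = E at *
  rw [div_eq_div_iff (by positivity) (by positivity)]
  field_simp
end
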